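/- Let N = 2^n with n ≥ 2, let F_N be the N×N DFT matrix, let R be the N×(N/2) reflection matrix and R̃ = R/√2 its normalisation. Then the (N/2)×(N/2) matrix S = R̃ᵀ F_N R̃ (the quantum/discrete sine transform) has entries S_{kl} = (2i/√N)·sin(2πkl/N) for all 0 ≤ k,l ≤ N/2−1. -/

import Mathlib

open Matrix

/-- The `N`-th root of unity `ω_N = exp(2πi/N)`. -/
noncomputable def omegaN (N : ℕ) : ℂ := Complex.exp (2 * Real.pi * Complex.I / N)

/-- The `N × N` discrete Fourier transform matrix with entries `(F_N)_{jk} = ω_N^{jk} / √N`. -/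
noncomputable def Fmat (N : ℕ) : Matrix (Fin N) (Fin N) ℂ :=
  fun j k => omegaN N ^ (j.val * k.val) / (Real.sqrt N : ℂ)

/-- The `N × (N/2)` reflection matrix for `N = 2^n`: `R_{k,k} = 1` and `R_{N−k,k} = −1` for
`1 ≤ k ≤ N/2 − 1`, all other entries zero. -/
noncomputable def Rmat (n : ℕ) : Matrix (Fin (2 ^ n)) (Fin (2 ^ (n - 1))) ℂ :=
  fun j k =>
    if k.val ≠ 0 ∧ j.val = k.val then 1
    else if k.val ≠ 0 ∧ j.val = 2 ^ n - k.val then -1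
    else 0

/-- The normalised reflection matrix `R̃ = R / √2`. -/
noncomputable def Rtil (n : ℕ) : Matrix (Fin (2 ^ n)) (Fin (2 ^ (n - 1))) ℂ :=
  (1 / (Real.sqrt 2 : ℂ)) • Rmat n

theorem omegaN_pow_self {N : ℕ} (hN : N ≠ 0) : omegaN N ^ N = 1 := by
  have : (N : ℂ) ≠ 0 := Nat.cast_ne_zero.mpr hN
  rw [omegaN, ← Complex.exp_nat_mul, mul_div_cancel₀ _ this, Complex.exp_two_pi_mul_I]

theorem omegaN_pow (N m : ℕ) :
    omegaN N ^ m = Complex.exp ((2 * Real.pi * m / N : ℂ) * Complex.I) := by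
  rw [omegaN, ← Complex.exp_nat_mul]
  congr 1
  ring

theorem omegaN_pow_sub_mul {N k : ℕ} (hN : N ≠ 0) (hk : k ≤ N) (l : ℕ) :
    omegaN N ^ ((N - k) * l) = (omegaN N ^ (k * l))⁻¹ := by
  apply eq_inv_of_mul_eq_one_left
  rw [← pow_add, ← add_mul, Nat.sub_add_cancel hk, pow_mul, omegaN_pow_self hN, one_pow]

/-- Pairing a column of the reflection matrix with an `N`-periodic sequence takes its
antisymmetric part. -/
theorem sum_Rmat_mul {n : ℕ} (hn : n ≠ 0) (k : Fin (2 ^ (n - 1))) (g : ℕ → ℂ)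
    (hg : g (2 ^ n) = g 0) :
    ∑ j : Fin (2 ^ n), Rmat n j k * g j = g k - g (2 ^ n - k) := by
  have hpow : 2 ^ n = 2 * 2 ^ (n - 1) := by rw [← pow_succ', Nat.sub_add_cancel (by omega)]
  have hk := k.isLt
  simp only [Rmat]
  rw [Fin.sum_univ_eq_sum_range (fun j => (if k.val ≠ 0 ∧ j = k.val then (1 : ℂ)
    else if k.val ≠ 0 ∧ j = 2 ^ n - k.val then -1 else 0) * g j)]
  by_cases h0 : k.val = 0
  · simp [h0, hg]
  · have hterm : ∀ j, (if k.val ≠ 0 ∧ j = k.val then (1 : ℂ)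
        else if k.val ≠ 0 ∧ j = 2 ^ n - k.val then -1 else 0) * g j =
        (if j = k.val then g j else 0) - (if j = 2 ^ n - k.val then g j else 0) := by
      intro j
      split_ifs <;> first | omega | simp_all
    simp_rw [hterm]
    rw [Finset.sum_sub_distrib, Finset.sum_ite_eq', Finset.sum_ite_eq',
      if_pos (Finset.mem_range.mpr (by omega)), if_pos (Finset.mem_range.mpr (by omega))]

/-- For `N = 2^n` with `n ≥ 2`, the quantum/discrete sine transform `S = R̃ᵀ F_N R̃` has
entries `S_{kl} = (2i/√N) · sin(2πkl/N)` for all `0 ≤ k,l ≤ N/2 − 1`. -/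
theorem sine_transform_entries (n : ℕ) (hn : 2 ≤ n) :
    ∀ (k l : Fin (2 ^ (n - 1))),
      ((Rtil n)ᵀ * Fmat (2 ^ n) * Rtil n) k l =
        2 * Complex.I / (Real.sqrt (2 ^ n) : ℂ) *
          Real.sin (2 * Real.pi * k.val * l.val / (2 ^ n : ℝ)) := by
  intro k l
  have hpow : 2 ^ n = 2 * 2 ^ (n - 1) := by rw [← pow_succ', Nat.sub_add_cancel (by omega)]
  have hN : 2 ^ n ≠ 0 := by positivity
  have hk : k.val ≤ 2 ^ n := by have := k.isLt; omega
  have hl : l.val ≤ 2 ^ n := by have := l.isLt; omega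
  set w := omegaN (2 ^ n) with hw
  have hleft (j : Fin (2 ^ n)) : ((Rmat n)ᵀ * Fmat (2 ^ n)) k j =
      (w ^ (k.val * j.val) - (w ^ (k.val * j.val))⁻¹) / (Real.sqrt (2 ^ n : ℕ) : ℂ) := by
    simp only [mul_apply, transpose_apply, Fmat]
    rw [sum_Rmat_mul (by omega) k (fun i => w ^ (i * j.val) / (Real.sqrt (2 ^ n : ℕ) : ℂ)),
      omegaN_pow_sub_mul hN hk, sub_div]
    simp only [pow_mul, hw, omegaN_pow_self hN, one_pow, pow_zero]
  have hmul : ((Rmat n)ᵀ * Fmat (2 ^ n) * Rmat n) k l =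
      2 * (w ^ (k.val * l.val) - (w ^ (k.val * l.val))⁻¹) / (Real.sqrt (2 ^ n : ℕ) : ℂ) := by
    rw [mul_apply]
    simp_rw [hleft, mul_comm _ (Rmat n _ l)]
    rw [sum_Rmat_mul (by omega) l (fun j => (w ^ (k.val * j) - (w ^ (k.val * j))⁻¹) /
      (Real.sqrt (2 ^ n : ℕ) : ℂ)), mul_comm k.val (2 ^ n - l.val),
      omegaN_pow_sub_mul hN hl, inv_inv, mul_comm l.val]
    · ring
    · simp only [mul_comm k.val, pow_mul, hw, omegaN_pow_self hN, one_pow, pow_zero]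
  have hsqrt : (1 / (Real.sqrt 2 : ℂ)) * (1 / (Real.sqrt 2 : ℂ)) = 1 / 2 := by
    rw [div_mul_div_comm, ← Complex.ofReal_mul, Real.mul_self_sqrt (by norm_num)]
    norm_num
  rw [Rtil, transpose_smul, smul_mul, smul_mul, Matrix.mul_smul, smul_smul, hsqrt, Matrix.smul_apply, hmul,
    hw, omegaN_pow, ← Complex.exp_neg, Complex.ofReal_sin, Complex.sin]
  push_cast
  rw [← mul_assoc (2 * (Real.pi : ℂ)), neg_mul, smul_eq_mul]
  ring_nf
  rw [Complex.I_sq]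
  ring
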